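/- arXiv:1010.4229 — 2 statements merged into one kernel-verified Lean document; each statement's English description precedes it below -/
import Mathlib

section
/- Let P ⊆ ℝ^d be a nonempty compact convex set, C ⊆ ℝ^d a 0-symmetric container (C = −C), and k, l natural numbers with 1 ≤ l ≤ k ≤ d. Then R_k(P,C) ≤ (2k/(k+1)) · R_l(P,C) if l ≤ (k+1)/2, and R_k(P,C) ≤ (k/l) · R_l(P,C) if l ≥ (k+1)/2; equivalently, R_k(P,C) ≤ min{2k/(k+1), k/l} · R_l(P,C). -/
open Set Pointwise

/-- The C-radius: least ρ ≥ 0 such that P ⊆ c + ρC for some c. -/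
noncomputable def cRadius {d : ℕ} (P C : Set (EuclideanSpace ℝ (Fin d))) : ℝ :=
  sInf {ρ : ℝ | 0 ≤ ρ ∧ ∃ c : EuclideanSpace ℝ (Fin d), P ⊆ c +ᵥ ρ • C}

/-- A container: a compact convex set with 0 in its interior. -/
def IsContainer {d : ℕ} (C : Set (EuclideanSpace ℝ (Fin d))) : Prop :=
  IsCompact C ∧ Convex ℝ C ∧ (0 : EuclideanSpace ℝ (Fin d)) ∈ interior C

/-- The k-th core-radius: `sup {R(S,C) : S ⊆ P, |S| ≤ k+1}`. -/
noncomputable def coreRadius {d : ℕ} (k : ℕ) (P C : Set (EuclideanSpace ℝ (Fin d))) : ℝ :=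
  sSup {r : ℝ | ∃ S : Set (EuclideanSpace ℝ (Fin d)),
    S ⊆ P ∧ S.Finite ∧ S.ncard ≤ k + 1 ∧ r = cRadius S C}


section helpers
variable {d : ℕ} {C : Set (EuclideanSpace ℝ (Fin d))}

lemma aux_nhds (hC : IsContainer C) : C ∈ nhds (0 : EuclideanSpace ℝ (Fin d)) :=
  mem_interior_iff_mem_nhds.1 hC.2.2

lemma aux_absorbent (hC : IsContainer C) : Absorbent ℝ C :=
  absorbent_nhds_zero (aux_nhds hC)

lemma aux_gauge_sum (hC : IsContainer C) {ι : Type*} (s : Finset ι)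
    (f : ι → EuclideanSpace ℝ (Fin d)) (r : ℝ) (h : ∀ i ∈ s, gauge C (f i) ≤ r) :
    gauge C (∑ i ∈ s, f i) ≤ s.card * r := by
  classical
  induction s using Finset.induction_on with
  | empty => simp
  | insert a s ha ih =>
    rw [Finset.sum_insert ha, Finset.card_insert_of_notMem ha]
    have h1 := gauge_add_le hC.2.1 (aux_absorbent hC) (f a) (∑ i ∈ s, f i)
    have h2 := h a (Finset.mem_insert_self _ _)
    have h3 := ih (fun i hi => h i (Finset.mem_insert_of_mem hi))
    push_cast
    linarith

lemma aux_bdd (S : Set (EuclideanSpace ℝ (Fin d))) :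
    BddBelow {ρ : ℝ | 0 ≤ ρ ∧ ∃ c : EuclideanSpace ℝ (Fin d), S ⊆ c +ᵥ ρ • C} :=
  ⟨0, fun _ h => h.1⟩

lemma aux_nonneg (S : Set (EuclideanSpace ℝ (Fin d))) : 0 ≤ cRadius S C :=
  Real.sInf_nonneg fun _ h => h.1

lemma aux_le (hC : IsContainer C) {S : Set (EuclideanSpace ℝ (Fin d))} {r : ℝ} (hr : 0 ≤ r)
    (c : EuclideanSpace ℝ (Fin d)) (h : ∀ p ∈ S, gauge C (p - c) ≤ r) : cRadius S C ≤ r := by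
  refine le_of_forall_gt_imp_ge_of_dense fun t ht => ?_
  have ht0 : 0 < t := lt_of_le_of_lt hr ht
  refine csInf_le (aux_bdd S) ⟨ht0.le, c, fun p hp => ?_⟩
  rw [Set.mem_vadd_set]
  refine ⟨p - c, ?_, by simp⟩
  rw [Set.mem_smul_set_iff_inv_smul_mem₀ ht0.ne']
  apply setOfPred_gauge_lt_one_subset_self hC.2.1 (interior_subset hC.2.2) (aux_absorbent hC)
  show gauge C (t⁻¹ • (p - c)) < 1
  rw [gauge_smul_of_nonneg (inv_nonneg.2 ht0.le), smul_eq_mul, inv_mul_lt_one₀ ht0]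
  exact lt_of_le_of_lt (h p hp) ht

lemma aux_bound (hC : IsContainer C) {P : Set (EuclideanSpace ℝ (Fin d))} (hP : IsCompact P) :
    ∃ M, 0 ≤ M ∧ ∀ p ∈ P, gauge C p ≤ M := by
  obtain ⟨M, hM⟩ := (hP.image (continuous_gauge hC.2.1 (aux_nhds hC))).bddAbove
  exact ⟨max M 0, le_max_right _ _, fun p hp => (hM ⟨p, hp, rfl⟩).trans (le_max_left _ _)⟩

lemma aux_exists (hC : IsContainer C) {S : Set (EuclideanSpace ℝ (Fin d))} (hS : S.Finite) {r : ℝ}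
    (h : cRadius S C < r) : ∃ c, ∀ p ∈ S, gauge C (p - c) ≤ r := by
  have hne : {ρ : ℝ | 0 ≤ ρ ∧ ∃ c : EuclideanSpace ℝ (Fin d), S ⊆ c +ᵥ ρ • C}.Nonempty := by
    obtain ⟨M, hM0, hM⟩ := aux_bound hC hS.isCompact
    refine ⟨M + 1, by linarith, 0, fun p hp => ?_⟩
    have ht0 : 0 < M + 1 := by linarith
    rw [zero_vadd, Set.mem_smul_set_iff_inv_smul_mem₀ ht0.ne']
    apply setOfPred_gauge_lt_one_subset_self hC.2.1 (interior_subset hC.2.2) (aux_absorbent hC)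
    show gauge C ((M + 1)⁻¹ • p) < 1
    rw [gauge_smul_of_nonneg (inv_nonneg.2 ht0.le), smul_eq_mul, inv_mul_lt_one₀ ht0]
    linarith [hM p hp]
  obtain ⟨ρ, ⟨hρ0, c, hc⟩, hρ⟩ := exists_lt_of_csInf_lt hne h
  refine ⟨c, fun p hp => ?_⟩
  obtain ⟨y, hy, rfl⟩ := Set.mem_vadd_set.1 (hc hp)
  simp only [vadd_eq_add, add_sub_cancel_left]
  exact (gauge_le_of_mem hρ0 hy).trans hρ.le

lemma aux_core_bdd (hC : IsContainer C) {P : Set (EuclideanSpace ℝ (Fin d))} (hP : IsCompact P)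
    (k : ℕ) : BddAbove {r : ℝ | ∃ S : Set (EuclideanSpace ℝ (Fin d)),
    S ⊆ P ∧ S.Finite ∧ S.ncard ≤ k + 1 ∧ r = cRadius S C} := by
  obtain ⟨M, hM0, hM⟩ := aux_bound hC hP
  refine ⟨M, ?_⟩
  rintro _ ⟨S, hS, -, -, rfl⟩
  exact aux_le hC hM0 0 fun p hp => by simpa using hM p (hS hp)

lemma aux_le_core (hC : IsContainer C) {P : Set (EuclideanSpace ℝ (Fin d))} (hP : IsCompact P)
    (k : ℕ) {S : Set (EuclideanSpace ℝ (Fin d))} (hS : S ⊆ P) (hf : S.Finite)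
    (hk : S.ncard ≤ k + 1) : cRadius S C ≤ coreRadius k P C :=
  le_csSup (aux_core_bdd hC hP k) ⟨S, hS, hf, hk, rfl⟩

lemma aux_core_le {P : Set (EuclideanSpace ℝ (Fin d))} (k : ℕ) {r : ℝ}
    (h : ∀ F : Finset (EuclideanSpace ℝ (Fin d)), (F : Set (EuclideanSpace ℝ (Fin d))) ⊆ P →
      F.card ≤ k + 1 → cRadius (F : Set (EuclideanSpace ℝ (Fin d))) C ≤ r) :
    coreRadius k P C ≤ r := by
  refine csSup_le ⟨_, ∅, empty_subset _, finite_empty, by simp, rfl⟩ ?_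
  rintro _ ⟨S, hS, hf, hk, rfl⟩
  lift S to Finset (EuclideanSpace ℝ (Fin d)) using hf
  exact h S hS (by simpa [Set.ncard_coe_finset] using hk)

lemma aux_core_nonneg {P : Set (EuclideanSpace ℝ (Fin d))} (k : ℕ) : 0 ≤ coreRadius k P C := by
  apply Real.sSup_nonneg
  rintro _ ⟨S, -, -, -, rfl⟩
  exact aux_nonneg S

lemma aux_mono (hC : IsContainer C) {P : Set (EuclideanSpace ℝ (Fin d))} (hP : IsCompact P)
    {k l : ℕ} (h : l ≤ k) : coreRadius l P C ≤ coreRadius k P C :=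
  aux_core_le l fun F hF hc => aux_le_core hC hP k hF F.finite_toSet
    (by rw [Set.ncard_coe_finset]; omega)

lemma aux_eps {A R t : ℝ} (ht : 0 ≤ t) (h : ∀ r, R < r → A ≤ t * r) : A ≤ t * R := by
  refine le_of_forall_pos_le_add fun ε hε => ?_
  have h1 := h (R + ε / (t + 1)) (by have : 0 < ε / (t + 1) := by positivity
                                     linarith)
  have h2 : t * (ε / (t + 1)) ≤ ε := by
    rw [mul_div_assoc', div_le_iff₀ (by positivity)]
    nlinarith
  linarith

/-- One step: `R_{n+2} ≤ (n+2)/(n+1) R_{n+1}`. -/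
lemma aux_step (hC : IsContainer C) {P : Set (EuclideanSpace ℝ (Fin d))} (hP : IsCompact P)
    (n : ℕ) : coreRadius (n + 2) P C ≤ (((n : ℝ) + 2) / (n + 1)) * coreRadius (n + 1) P C := by
  classical
  refine aux_eps (by positivity) fun r hr => ?_
  have hr0 : 0 ≤ r := (aux_core_nonneg _).trans hr.le
  refine aux_core_le _ fun F hF hc => ?_
  rcases Nat.lt_or_ge F.card (n + 3) with hlt | hge
  · have h1 : cRadius (F : Set (EuclideanSpace ℝ (Fin d))) C ≤ coreRadius (n + 1) P C :=
      aux_le_core hC hP _ hF F.finite_toSet (by rw [Set.ncard_coe_finset]; omega)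
    have h2 : 1 ≤ ((n : ℝ) + 2) / (n + 1) := by
      rw [le_div_iff₀ (by positivity)]; linarith
    nlinarith
  have hcard : F.card = n + 3 := by omega
  have hex : ∀ p, ∃ c, p ∈ F → ∀ q ∈ F.erase p, gauge C (q - c) ≤ r := by
    intro p
    by_cases hp : p ∈ F
    · obtain ⟨c, hc⟩ := aux_exists hC (F.erase p).finite_toSet (r := r)
        (lt_of_le_of_lt (aux_le_core hC hP (n + 1)
          (fun x hx => hF (Finset.mem_of_mem_erase hx)) (F.erase p).finite_toSet
          (by rw [Set.ncard_coe_finset, Finset.card_erase_of_mem hp]; omega)) hr)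
      exact ⟨c, fun _ q hq => hc q hq⟩
    · exact ⟨0, fun h => absurd h hp⟩
  choose c hcc using hex
  set b : ℝ := 1 / (((n : ℝ) + 1) * (n + 3)) with hb
  set a : ℝ := ((n : ℝ) + 2) * b with ha
  have hb0 : 0 ≤ b := by positivity
  have ha0 : 0 ≤ a := by positivity
  refine aux_le hC (by positivity) (a • ∑ p ∈ F, c p - b • ∑ p ∈ F, p) fun q hq => ?_
  have hq' : q ∈ F := hq
  have hce : (F.erase q).card = n + 2 := by rw [Finset.card_erase_of_mem hq']; omega
  have key : q - (a • ∑ p ∈ F, c p - b • ∑ p ∈ F, p) =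
      a • (∑ p ∈ F.erase q, (q - c p)) + b • ∑ p ∈ F.erase q, (p - c q) := by
    rw [← Finset.add_sum_erase F c hq', ← Finset.add_sum_erase F (fun p => p) hq',
      Finset.sum_sub_distrib, Finset.sum_sub_distrib, Finset.sum_const, Finset.sum_const, hce,
      ← Nat.cast_smul_eq_nsmul ℝ, ← Nat.cast_smul_eq_nsmul ℝ]
    push_cast
    have h1 : a * ((n : ℝ) + 2) = 1 + b := by
      rw [ha, hb]; field_simp; ring
    have h2 : (a * ((n : ℝ) + 2)) • q = (1 + b) • q := by rw [h1]
    have h3 : a • c q = (b * ((n : ℝ) + 2)) • c q := by rw [ha, mul_comm]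
    rw [mul_smul] at h2
    simp only [smul_add, smul_sub, h2, h3]
    module
  rw [key]
  have g1 := aux_gauge_sum hC (F.erase q) (fun p => q - c p) r fun p hp =>
    hcc p (Finset.mem_of_mem_erase hp) q
      (Finset.mem_erase.2 ⟨(Finset.ne_of_mem_erase hp).symm, hq'⟩)
  have g2 := aux_gauge_sum hC (F.erase q) (fun p => p - c q) r fun p hp => hcc q hq' p hp
  rw [hce] at g1 g2
  refine (gauge_add_le hC.2.1 (aux_absorbent hC) _ _).trans ?_
  rw [gauge_smul_of_nonneg ha0, gauge_smul_of_nonneg hb0, smul_eq_mul, smul_eq_mul]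
  have g3 := mul_le_mul_of_nonneg_left g1 ha0
  have g4 := mul_le_mul_of_nonneg_left g2 hb0
  refine (add_le_add g3 g4).trans (le_of_eq ?_)
  rw [ha, hb]; push_cast; field_simp; ring

lemma aux_ratio (hC : IsContainer C) {P : Set (EuclideanSpace ℝ (Fin d))} (hP : IsCompact P)
    {k l : ℕ} (hl : 1 ≤ l) (h : l ≤ k) :
    coreRadius k P C ≤ ((k : ℝ) / l) * coreRadius l P C := by
  have hl0 : (0 : ℝ) < l := by exact_mod_cast hl
  induction k, h using Nat.le_induction with
  | base => rw [div_self hl0.ne', one_mul]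
  | succ k hk ih =>
    obtain ⟨n, rfl⟩ : ∃ n, k = n + 1 := ⟨k - 1, by omega⟩
    refine (aux_step hC hP n).trans ((mul_le_mul_of_nonneg_left ih (by positivity)).trans
      (le_of_eq ?_))
    push_cast
    field_simp
    ring

lemma aux_symm (hC : IsContainer C) (hs : C = -C) {P : Set (EuclideanSpace ℝ (Fin d))}
    (hP : IsCompact P) (k : ℕ) :
    coreRadius k P C ≤ (2 * (k : ℝ) / (k + 1)) * coreRadius 1 P C := by
  classical
  refine aux_eps (by positivity) fun r hr => ?_
  have hr0 : 0 ≤ r := (aux_core_nonneg _).trans hr.le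
  refine aux_core_le _ fun F hF hc => ?_
  have hneg : ∀ x, gauge C (-x) = gauge C x := fun x =>
    gauge_neg (fun y hy => by rw [hs]; simpa using hy) x
  have hpair : ∀ p ∈ F, ∀ q ∈ F, gauge C (p - q) ≤ 2 * r := by
    intro p hp q hq
    obtain ⟨c, hcc⟩ := aux_exists hC (S := {p, q}) (by simp) (r := r)
      (lt_of_le_of_lt (aux_le_core hC hP 1 (by
        rintro x (rfl | rfl)
        · exact hF hp
        · exact hF hq) (by simp) ((Set.ncard_insert_le p {q}).trans (by simp))) hr)
    have h1 := hcc p (by simp)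
    have h2 := hcc q (by simp)
    have h3 := gauge_add_le hC.2.1 (aux_absorbent hC) (p - c) (-(q - c))
    rw [hneg, show p - c + -(q - c) = p - q by abel] at h3
    linarith
  have hk1 : (0 : ℝ) < (k : ℝ) + 1 := by positivity
  rcases F.eq_empty_or_nonempty with rfl | hne
  · exact aux_le hC (by positivity) 0 (by simp)
  obtain ⟨m, hm⟩ : ∃ m, F.card = m + 1 := ⟨F.card - 1, by have := hne.card_pos; omega⟩
  have hm0 : (0 : ℝ) < (m : ℝ) + 1 := by positivity
  have hmk : (m : ℝ) ≤ k := by exact_mod_cast (by omega : m ≤ k)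
  refine aux_le hC (by positivity) (((m : ℝ) + 1)⁻¹ • ∑ p ∈ F, p) fun q hq => ?_
  have hq' : q ∈ F := hq
  have hce : (F.erase q).card = m := by rw [Finset.card_erase_of_mem hq']; omega
  have key : q - ((m : ℝ) + 1)⁻¹ • ∑ p ∈ F, p = ((m : ℝ) + 1)⁻¹ • ∑ p ∈ F.erase q, (q - p) := by
    rw [← Finset.add_sum_erase F (fun p => p) hq', Finset.sum_sub_distrib, Finset.sum_const, hce,
      ← Nat.cast_smul_eq_nsmul ℝ]
    have h1 : q = (((m : ℝ) + 1)⁻¹ * (m + 1)) • q := by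
      rw [inv_mul_cancel₀ hm0.ne', one_smul]
    nth_rewrite 1 [h1]
    module
  rw [key, gauge_smul_of_nonneg (by positivity), smul_eq_mul]
  have g1 := aux_gauge_sum hC (F.erase q) (fun p => q - p) (2 * r) fun p hp =>
    hpair q hq' p (Finset.mem_of_mem_erase hp)
  rw [hce] at g1
  refine (mul_le_mul_of_nonneg_left g1 (by positivity)).trans ?_
  have h2 : ((m : ℝ) + 1)⁻¹ * m ≤ k / (k + 1) := by
    rw [inv_mul_eq_div, div_le_div_iff₀ hm0 hk1]; nlinarith
  calc ((m : ℝ) + 1)⁻¹ * (m * (2 * r)) = (((m : ℝ) + 1)⁻¹ * m) * (2 * r) := by ring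
    _ ≤ (k / (k + 1)) * (2 * r) := mul_le_mul_of_nonneg_right h2 (by positivity)
    _ = _ := by ring

end helpers

theorem coreRadius_ratio_symmetric {d : ℕ} (P C : Set (EuclideanSpace ℝ (Fin d)))
    (hPne : P.Nonempty) (hPcomp : IsCompact P) (hPconv : Convex ℝ P)
    (hC : IsContainer C) (hCsymm : C = -C)
    (k l : ℕ) (hl : 1 ≤ l) (hlk : l ≤ k) (hkd : k ≤ d) :
    ((l : ℝ) ≤ ((k : ℝ) + 1) / 2 →
      coreRadius k P C ≤ (2 * (k : ℝ) / ((k : ℝ) + 1)) * coreRadius l P C) ∧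
    (((k : ℝ) + 1) / 2 ≤ (l : ℝ) →
      coreRadius k P C ≤ ((k : ℝ) / (l : ℝ)) * coreRadius l P C) := by
  refine ⟨fun _ => ?_, fun _ => aux_ratio hC hPcomp hl hlk⟩
  exact (aux_symm hC hCsymm hPcomp k).trans
    (mul_le_mul_of_nonneg_left (aux_mono hC hPcomp hl) (by positivity))
end

section
/- Let 1 ≤ l ≤ k ≤ d, let T^k be a regular k-simplex with centroid at the origin embedded in the subspace of the first k coordinates of ℝ^d, and let C^k = (T^k ∩ (−T^k)) + ({0}^k × [−1,1]^{d−k}), a 0-symmetric container in ℝ^d. Then R_k(T^k, C^k) = (2k/(k+1)) · R_l(T^k, C^k) if l ≤ (k+1)/2, and R_k(T^k, C^k) = (k/l) · R_l(T^k, C^k) if l ≥ (k+1)/2; hence the core-radii inequality for 0-symmetric containers is sharp for all pairs (k,l). -/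
open Set Pointwise

/-- `v` lists the vertices of a regular `k`-simplex with centroid at the origin, embedded in
the subspace of the first `k` coordinates of `ℝ^d`. -/
def IsEmbeddedRegularSimplex {d : ℕ} (k : ℕ) (v : Fin (k + 1) → EuclideanSpace ℝ (Fin d)) : Prop :=
  AffineIndependent ℝ v ∧ (∃ r : ℝ, 0 < r ∧ ∀ i j, i ≠ j → dist (v i) (v j) = r) ∧
    (∑ i, v i = 0) ∧ (∀ i, ∀ j : Fin d, k ≤ (j : ℕ) → v i j = 0)

/-- Uniqueness of coordinates with a given total. -/
lemma aux_unique {d k : ℕ} {v : Fin (k + 1) → EuclideanSpace ℝ (Fin d)}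
    (hv : AffineIndependent ℝ v) (a b : Fin (k + 1) → ℝ) (hs : ∑ j, a j = ∑ j, b j)
    (h : ∑ j, a j • v j = ∑ j, b j • v j) : a = b := by
  rw [affineIndependent_iff] at hv
  funext j
  have := hv Finset.univ (fun j => a j - b j) (by simp [hs])
    (by simp [sub_smul, Finset.sum_sub_distrib, h]) j (Finset.mem_univ j)
  linarith

lemma aux_hull {d k : ℕ} (v : Fin (k + 1) → EuclideanSpace ℝ (Fin d)) (x) :
    x ∈ convexHull ℝ (Set.range v) ↔
      ∃ w : Fin (k + 1) → ℝ, (∀ j, 0 ≤ w j) ∧ ∑ j, w j = 1 ∧ ∑ j, w j • v j = x := by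
  rw [convexHull_range_eq_exists_affineCombination] 
  constructor
  · rintro ⟨s, w, h0, h1, rfl⟩
    refine ⟨fun j => if j ∈ s then w j else 0, ?_, ?_, ?_⟩
    · intro j
      dsimp only
      split_ifs with h
      · exact h0 j h
      · exact le_rfl
    · simpa [Finset.sum_ite_mem] using h1
    · rw [Finset.affineCombination_eq_linear_combination s v w h1]
      simp [ite_smul, Finset.sum_ite_mem]
  · rintro ⟨w, h0, h1, rfl⟩
    exact ⟨Finset.univ, w, fun j _ => h0 j, h1,
      Finset.affineCombination_eq_linear_combination _ v w h1⟩

lemma aux_sym {d k : ℕ} {v : Fin (k + 1) → EuclideanSpace ℝ (Fin d)}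
    (hv : AffineIndependent ℝ v) (h0 : ∑ i, v i = 0) (x) :
    x ∈ convexHull ℝ (Set.range v) ∩ -convexHull ℝ (Set.range v) ↔
      ∃ a : Fin (k + 1) → ℝ, ∑ j, a j = 0 ∧ (∀ j, |a j| ≤ 1 / ((k : ℝ) + 1)) ∧
        ∑ j, a j • v j = x := by
  have hn : (0 : ℝ) < (k : ℝ) + 1 := by positivity
  have hc : ∑ _j : Fin (k + 1), 1 / ((k : ℝ) + 1) = 1 := by
    simp; field_simp
  have hz : ∀ r : ℝ, ∑ j, r • v j = 0 := by
    intro r; rw [← Finset.smul_sum, h0, smul_zero]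
  rw [Set.mem_inter_iff, Set.mem_neg, aux_hull, aux_hull]
  constructor
  · rintro ⟨⟨w, w0, w1, rfl⟩, ⟨u, u0, u1, hu⟩⟩
    have key := aux_unique hv (fun j => w j + u j)
      (fun _ => 1 / ((k : ℝ) + 1) + 1 / ((k : ℝ) + 1))
      (by rw [Finset.sum_add_distrib, Finset.sum_add_distrib, w1, u1, hc])
      (by rw [hz]; simp only [add_smul, Finset.sum_add_distrib]; rw [hu]; simp)
    refine ⟨fun j => w j - 1 / ((k : ℝ) + 1), ?_, ?_, ?_⟩
    · rw [Finset.sum_sub_distrib, w1, hc]; simp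
    · intro j
      have := congrFun key j
      have a := w0 j
      have b := u0 j
      rw [abs_le]
      constructor <;> linarith
    · simp only [sub_smul, Finset.sum_sub_distrib]
      rw [hz, sub_zero]
  · rintro ⟨a, a0, a1, rfl⟩
    refine ⟨⟨fun j => 1 / ((k : ℝ) + 1) + a j, ?_, ?_, ?_⟩,
      ⟨fun j => 1 / ((k : ℝ) + 1) - a j, ?_, ?_, ?_⟩⟩
    · intro j; have := abs_le.1 (a1 j); simp only; linarith
    · rw [Finset.sum_add_distrib, hc, a0, add_zero]
    · simp only [add_smul, Finset.sum_add_distrib]; rw [hz, zero_add]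
    · intro j; have := abs_le.1 (a1 j); simp only; linarith
    · rw [Finset.sum_sub_distrib, hc, a0, sub_zero]
    · simp only [sub_smul, Finset.sum_sub_distrib]; rw [hz, zero_sub]

lemma aux_center {n : ℕ} {A B : Fin n → ℝ} (hAB : ∀ i, A i ≤ B i) (h1 : ∑ i, A i ≤ 1)
    (h2 : 1 ≤ ∑ i, B i) : ∃ c : Fin n → ℝ, ∑ i, c i = 1 ∧ ∀ i, A i ≤ c i ∧ c i ≤ B i := by
  obtain ⟨t, t0, t1, ht⟩ : ∃ t : ℝ, 0 ≤ t ∧ t ≤ 1 ∧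
      (∑ i, A i) + t * (∑ i, B i - ∑ i, A i) = 1 := by
    rcases eq_or_lt_of_le (h1.trans h2) with h | h
    · exact ⟨0, le_rfl, zero_le_one, by linarith⟩
    · have hp : 0 < ∑ i, B i - ∑ i, A i := by linarith
      refine ⟨(1 - ∑ i, A i) / (∑ i, B i - ∑ i, A i), div_nonneg (by linarith) hp.le, ?_, ?_⟩
      · rw [div_le_one hp]; linarith
      · field_simp; ring
  refine ⟨fun i => A i + t * (B i - A i), ?_, ?_⟩
  · rw [Finset.sum_add_distrib, ← Finset.mul_sum, Finset.sum_sub_distrib, ht]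
  · intro i
    have := hAB i
    constructor <;> nlinarith

/-- Upper bound: any at most `l+1` points of the simplex are covered. -/
lemma aux_upper {d k l : ℕ} (hl : 1 ≤ l)
    {v : Fin (k + 1) → EuclideanSpace ℝ (Fin d)} (hv : AffineIndependent ℝ v)
    (h0 : ∑ i, v i = 0) {Q S : Set (EuclideanSpace ℝ (Fin d))} (hQ : 0 ∈ Q)
    (hS : S ⊆ convexHull ℝ (Set.range v)) (hf : S.Finite) (hcard : S.ncard ≤ l + 1) (ρ : ℝ)
    (hρ1 : ((k : ℝ) + 1) / 2 ≤ ρ) (hρ2 : (l : ℝ) ≤ ρ) :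
    ∃ c : EuclideanSpace ℝ (Fin d), S ⊆ c +ᵥ ρ •
      ((convexHull ℝ (Set.range v) ∩ -convexHull ℝ (Set.range v)) + Q) := by
  have hn : (0 : ℝ) < (k : ℝ) + 1 := by positivity
  have hl' : (1 : ℝ) ≤ l := by exact_mod_cast hl
  have hρ : 0 < ρ := by linarith
  have hw : ∀ s : EuclideanSpace ℝ (Fin d), ∃ w : Fin (k + 1) → ℝ, s ∈ S →
      (∀ j, 0 ≤ w j) ∧ ∑ j, w j = 1 ∧ ∑ j, w j • v j = s := by
    intro s
    by_cases h : s ∈ S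
    · obtain ⟨w, hw⟩ := (aux_hull v s).1 (hS h)
      exact ⟨w, fun _ => hw⟩
    · exact ⟨0, fun h' => absurd h' h⟩
  choose w hw using hw
  have hm : ∀ s, s ∈ hf.toFinset ↔ s ∈ S := fun s => hf.mem_toFinset
  let M : Fin (k + 1) → ℝ := fun i => min 1 (∑ s ∈ hf.toFinset, w s i)
  have hM : ∑ i, M i ≤ (l : ℝ) + 1 := by
    calc ∑ i, M i ≤ ∑ i, ∑ s ∈ hf.toFinset, w s i :=
          Finset.sum_le_sum fun i _ => min_le_right _ _
      _ = ∑ s ∈ hf.toFinset, ∑ i, w s i := Finset.sum_comm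
      _ = ∑ s ∈ hf.toFinset, 1 := Finset.sum_congr rfl fun s hs => (hw s ((hm s).1 hs)).2.1
      _ = (S.ncard : ℝ) := by simp [Set.ncard_eq_toFinset_card S hf]
      _ ≤ (l : ℝ) + 1 := by exact_mod_cast hcard
  have hMw : ∀ s ∈ S, ∀ i, w s i ≤ M i := by
    intro s hs i
    refine le_min ?_ ?_
    · rw [← (hw s hs).2.1]
      exact Finset.single_le_sum (f := fun j => w s j) (fun j _ => (hw s hs).1 j)
        (Finset.mem_univ i)
    · exact Finset.single_le_sum (f := fun s => w s i)
        (fun t ht => (hw t ((hm t).1 ht)).1 i) ((hm s).2 hs)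
  have hsum : ∑ _i : Fin (k + 1), ρ / ((k : ℝ) + 1) = ρ := by
    simp; field_simp
  have hhalf : 1 / 2 ≤ ρ / ((k : ℝ) + 1) := by
    rw [le_div_iff₀ hn]; linarith
  obtain ⟨c, c1, hc⟩ := aux_center (A := fun i => M i - ρ / ((k : ℝ) + 1))
    (B := fun _ => ρ / ((k : ℝ) + 1))
    (by intro i; have : M i ≤ 1 := min_le_left _ _; linarith)
    (by rw [Finset.sum_sub_distrib, hsum]; linarith) 
    (by rw [hsum]; linarith)
  refine ⟨∑ j, c j • v j, ?_⟩
  intro s hs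
  obtain ⟨w0, w1, ws⟩ := hw s hs
  have hmem : ∑ j, ((w s j - c j) / ρ) • v j ∈
      convexHull ℝ (Set.range v) ∩ -convexHull ℝ (Set.range v) := by
    rw [aux_sym hv h0]
    refine ⟨_, ?_, ?_, rfl⟩
    · rw [← Finset.sum_div, Finset.sum_sub_distrib, w1, c1]; simp
    · intro j
      have h1 := hc j
      have h2 := hMw s hs j
      have h3 := w0 j
      rw [abs_div, abs_of_pos hρ, div_le_iff₀ hρ, one_div_mul_eq_div, abs_le]
      constructor <;> linarith
  rw [Set.mem_vadd_set]
  refine ⟨ρ • (∑ j, ((w s j - c j) / ρ) • v j), 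
    Set.smul_mem_smul_set ⟨_, hmem, 0, hQ, add_zero _⟩, ?_⟩
  rw [Finset.smul_sum]
  simp only [smul_smul, mul_div_cancel₀ _ hρ.ne', sub_smul, Finset.sum_sub_distrib, vadd_eq_add]
  rw [ws]; abel

lemma aux_lower {d k l : ℕ} (hl : 1 ≤ l) (hlk : l ≤ k)
    {v : Fin (k + 1) → EuclideanSpace ℝ (Fin d)} (hv : AffineIndependent ℝ v)
    (h0 : ∑ i, v i = 0) (hvk : ∀ i, ∀ j : Fin d, k ≤ (j : ℕ) → v i j = 0)
    {Q : Set (EuclideanSpace ℝ (Fin d))} (hQ : ∀ x ∈ Q, ∀ j : Fin d, (j : ℕ) < k → x j = 0)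
    (ρ : ℝ) (hρ : 0 ≤ ρ) (c : EuclideanSpace ℝ (Fin d))
    (h : v '' {i | (i : ℕ) ≤ l} ⊆ c +ᵥ ρ •
      ((convexHull ℝ (Set.range v) ∩ -convexHull ℝ (Set.range v)) + Q)) :
    ((k : ℝ) + 1) / 2 ≤ ρ ∧ (l : ℝ) ≤ ρ := by
  have hn : (0 : ℝ) < (k : ℝ) + 1 := by positivity
  have ha : ∀ i : Fin (k + 1), ∃ (a : Fin (k + 1) → ℝ) (u : EuclideanSpace ℝ (Fin d)),
      (i : ℕ) ≤ l → ∑ j, a j = 0 ∧ (∀ j, |a j| ≤ 1 / ((k : ℝ) + 1)) ∧ u ∈ Q ∧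
        v i = c + ρ • (∑ j, a j • v j + u) := by
    intro i
    by_cases hi : (i : ℕ) ≤ l
    · obtain ⟨y, ⟨z, ⟨t, ht, u, hu, rfl⟩, rfl⟩, hy⟩ := h ⟨i, hi, rfl⟩
      obtain ⟨a, a0, a1, rfl⟩ := (aux_sym hv h0 t).1 ht
      exact ⟨a, u, fun _ => ⟨a0, a1, hu, hy.symm⟩⟩
    · exact ⟨0, 0, fun h' => absurd h' hi⟩
  choose a u hau using ha
  have hvan : ∀ (b : Fin (k + 1) → ℝ) (j : Fin d), k ≤ (j : ℕ) → (∑ i, b i • v i) j = 0 := by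
    intro b j hj
    simp [hvk _ j hj]
  obtain ⟨z0, z1, zu, zv⟩ := hau 0 (by simp)
  have key : ∀ i : Fin (k + 1), (i : ℕ) ≤ l → ∀ j,
      (Pi.single i 1 : Fin (k + 1) → ℝ) j - (Pi.single 0 1 : Fin (k + 1) → ℝ) j
        = ρ * (a i j - a 0 j) := by
    intro i hi
    obtain ⟨i0, i1, iu, iv⟩ := hau i hi
    have e : v i - v 0 = ∑ j, (ρ * (a i j - a 0 j)) • v j := by
      have e1 : ∑ j, (ρ * (a i j - a 0 j)) • v j
          = ρ • (∑ j, a i j • v j) - ρ • ∑ j, a 0 j • v j := by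
        simp only [mul_smul, sub_smul, ← Finset.smul_sum, Finset.sum_sub_distrib, smul_sub]
      have e2 : v i - v 0 = ∑ j, (ρ * (a i j - a 0 j)) • v j + ρ • (u i - u 0) := by
        rw [e1, smul_sub]
        calc v i - v 0 = (c + ρ • (∑ j, a i j • v j + u i)) -
              (c + ρ • (∑ j, a 0 j • v j + u 0)) := by rw [← iv, ← zv]
          _ = _ := by rw [smul_add, smul_add]; abel
      have e3 : ρ • (u i - u 0) = 0 := by
        ext j
        by_cases hj : (j : ℕ) < k
        · simp [hQ _ iu j hj, hQ _ zu j hj]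
        · have hj' : k ≤ (j : ℕ) := not_lt.1 hj
          have e4 : (v i - v 0) j = (∑ j, (ρ * (a i j - a 0 j)) • v j) j + (ρ • (u i - u 0)) j :=
            congrArg (fun x : EuclideanSpace ℝ (Fin d) => x j) e2
          rw [hvan _ j hj'] at e4
          have e5 : (v i - v 0) j = 0 := by simp [hvk _ j hj']
          rw [e5] at e4
          simpa using e4.symm
      rw [e2, e3, add_zero]
    intro j
    refine congrFun (aux_unique hv
      (fun j => (Pi.single i 1 : Fin (k + 1) → ℝ) j - (Pi.single 0 1 : Fin (k + 1) → ℝ) j)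
      (fun j => ρ * (a i j - a 0 j)) ?_ ?_) j
    · rw [← Finset.mul_sum, Finset.sum_sub_distrib, Finset.sum_sub_distrib, i0, z0]
      simp
    · rw [← e]
      simp [sub_smul, Finset.sum_sub_distrib, Pi.single_apply]
  have diag : ∀ i : Fin (k + 1), (i : ℕ) ≤ l → i ≠ 0 → 1 = ρ * (a i i - a 0 i) := by
    intro i hi hi0
    have := key i hi i
    simpa [Pi.single_apply, hi0] using this
  constructor
  · have h1l : ((⟨1, by omega⟩ : Fin (k + 1)) : ℕ) ≤ l := hl
    have e := diag ⟨1, by omega⟩ h1l (by simp [Fin.ext_iff])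
    have b1 := (abs_le.1 ((hau _ h1l).2.1 ⟨1, by omega⟩)).2
    have b2 := (abs_le.1 (z1 ⟨1, by omega⟩)).1
    have : 1 ≤ ρ * (2 / ((k : ℝ) + 1)) := by
      refine e.trans_le ?_
      refine mul_le_mul_of_nonneg_left ?_ hρ
      have : 2 / ((k : ℝ) + 1) = 1 / ((k : ℝ) + 1) + 1 / ((k : ℝ) + 1) := by ring
      linarith
    rw [← mul_div_assoc, le_div_iff₀ hn] at this
    linarith
  · let g : Fin (k + 1) → ℝ := fun j => if (j : ℕ) ≤ l then a j j else 1 / ((k : ℝ) + 1)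
    have hg : ∑ j, g j ≤ 1 := by
      calc ∑ j, g j ≤ ∑ _j : Fin (k + 1), 1 / ((k : ℝ) + 1) := by
            refine Finset.sum_le_sum fun j _ => ?_
            dsimp only [g]
            split_ifs with hj
            · exact (abs_le.1 ((hau j hj).2.1 j)).2
            · exact le_rfl
        _ = 1 := by simp; field_simp
    have hlow : ∑ j : Fin (k + 1), (if (j : ℕ) ∈ Finset.Icc 1 l then (1 : ℝ) else 0)
        ≤ ∑ j, ρ * (g j - a 0 j) := by
      refine Finset.sum_le_sum fun j _ => ?_
      dsimp only [g]
      by_cases hj : (j : ℕ) ≤ l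
      · by_cases hj0 : j = 0
        · subst hj0; simp
        · have : 1 ≤ (j : ℕ) := Nat.one_le_iff_ne_zero.2 fun h => hj0 (Fin.ext h)
          rw [if_pos hj, ← diag j hj hj0, if_pos (Finset.mem_Icc.2 ⟨this, hj⟩)]
      · rw [if_neg hj, if_neg (fun h => hj (Finset.mem_Icc.1 h).2)]
        exact mul_nonneg hρ (sub_nonneg.2 (abs_le.1 (z1 j)).2)
    have hcount : ∑ j : Fin (k + 1), (if (j : ℕ) ∈ Finset.Icc 1 l then (1 : ℝ) else 0) = l := by
      rw [Fin.sum_univ_eq_sum_range (fun j => if j ∈ Finset.Icc 1 l then (1 : ℝ) else 0) (k + 1),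
        Finset.sum_ite_mem, Finset.inter_eq_right.2]
      · simp
      · intro j hj
        have := (Finset.mem_Icc.1 hj).2
        exact Finset.mem_range.2 (by omega)
    rw [hcount, ← Finset.mul_sum, Finset.sum_sub_distrib, z0, sub_zero] at hlow
    nlinarith

lemma aux_main {d k l : ℕ} (hl : 1 ≤ l) (hlk : l ≤ k)
    (v : Fin (k + 1) → EuclideanSpace ℝ (Fin d)) (hv : IsEmbeddedRegularSimplex k v)
    (T C : Set (EuclideanSpace ℝ (Fin d))) (hT : T = convexHull ℝ (Set.range v))
    (hC : C = (T ∩ (-T)) +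
      {x : EuclideanSpace ℝ (Fin d) | (∀ j : Fin d, (j : ℕ) < k → x j = 0) ∧
        (∀ j : Fin d, k ≤ (j : ℕ) → x j ∈ Set.Icc (-1 : ℝ) 1)}) :
    coreRadius l T C = max (((k : ℝ) + 1) / 2) l := by
  obtain ⟨hai, -, h0, hvk⟩ := hv
  subst hT
  subst hC
  have hpos : (0 : ℝ) ≤ max (((k : ℝ) + 1) / 2) l := le_max_of_le_right (Nat.cast_nonneg l)
  have hub : ∀ S ⊆ convexHull ℝ (Set.range v), S.Finite → S.ncard ≤ l + 1 →
      max (((k : ℝ) + 1) / 2) l ∈ {ρ : ℝ | 0 ≤ ρ ∧ ∃ c : EuclideanSpace ℝ (Fin d), S ⊆ c +ᵥ ρ •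
      ((convexHull ℝ (Set.range v) ∩ -convexHull ℝ (Set.range v)) +
      {x : EuclideanSpace ℝ (Fin d) | (∀ j : Fin d, (j : ℕ) < k → x j = 0) ∧
        (∀ j : Fin d, k ≤ (j : ℕ) → x j ∈ Set.Icc (-1 : ℝ) 1)})} := by
    intro S hS hf hc
    exact ⟨hpos, aux_upper hl hai h0 (by simp) hS hf hc _ (le_max_left _ _) (le_max_right _ _)⟩
  unfold coreRadius
  apply IsGreatest.csSup_eq
  constructor
  · have hsub : v '' {i | (i : ℕ) ≤ l} ⊆ convexHull ℝ (Set.range v) :=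
      (Set.image_subset_range _ _).trans (subset_convexHull ℝ _)
    have hfin : (v '' {i : Fin (k + 1) | (i : ℕ) ≤ l}).Finite := Set.toFinite _
    have hcard : (v '' {i : Fin (k + 1) | (i : ℕ) ≤ l}).ncard ≤ l + 1 := by
      refine (Set.ncard_image_le (Set.toFinite _)).trans ?_
      have := Set.ncard_le_ncard_of_injOn (s := {i : Fin (k + 1) | (i : ℕ) ≤ l})
        (t := (Finset.range (l + 1) : Set ℕ)) (fun i => (i : ℕ))
        (fun i (hi : (i : ℕ) ≤ l) => by simpa [Nat.lt_succ_iff] using hi)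
        (Fin.val_injective.injOn) (Finset.finite_toSet _)
      simpa only [Set.ncard_coe_finset, Finset.card_range] using this
    refine ⟨_, hsub, hfin, hcard, ?_⟩
    symm
    apply IsLeast.csInf_eq
    refine ⟨hub _ hsub hfin hcard, ?_⟩
    rintro ρ ⟨hρ, c, hc⟩
    have := aux_lower hl hlk hai h0 hvk (fun x hx => hx.1) ρ hρ c hc
    exact max_le this.1 this.2
  · rintro r ⟨S, hS, hf, hc, rfl⟩
    exact csInf_le ⟨0, fun x hx => hx.1⟩ (hub S hS hf hc)

theorem coreRadius_symmetric_sharp {d k l : ℕ} (hl : 1 ≤ l) (hlk : l ≤ k) (hkd : k ≤ d)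
    (v : Fin (k + 1) → EuclideanSpace ℝ (Fin d)) (hv : IsEmbeddedRegularSimplex k v)
    (T C : Set (EuclideanSpace ℝ (Fin d))) (hT : T = convexHull ℝ (Set.range v))
    (hC : C = (T ∩ (-T)) +
      {x : EuclideanSpace ℝ (Fin d) | (∀ j : Fin d, (j : ℕ) < k → x j = 0) ∧
        (∀ j : Fin d, k ≤ (j : ℕ) → x j ∈ Set.Icc (-1 : ℝ) 1)}) :
    ((l : ℝ) ≤ ((k : ℝ) + 1) / 2 →
      coreRadius k T C = (2 * (k : ℝ) / ((k : ℝ) + 1)) * coreRadius l T C) ∧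
    (((k : ℝ) + 1) / 2 ≤ (l : ℝ) →
      coreRadius k T C = ((k : ℝ) / (l : ℝ)) * coreRadius l T C) := by
  have hk := aux_main (hl.trans hlk) le_rfl v hv T C hT hC
  have hl1 := aux_main hl hlk v hv T C hT hC
  have hl' : (1 : ℝ) ≤ l := by exact_mod_cast hl
  have hk' : (l : ℝ) ≤ k := by exact_mod_cast hlk
  rw [max_eq_right (by linarith)] at hk
  rw [hk, hl1]
  constructor
  · intro h
    rw [max_eq_left h]
    have : (k : ℝ) + 1 ≠ 0 := by positivity
    field_simp
  · intro h
    rw [max_eq_right h]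
    have : (l : ℝ) ≠ 0 := by positivity
    field_simp
end
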